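/- Let f: ℝⁿ → {e₁,…,e_k} be measurable and let t > 0. If g ∈ T_z(P_t f) for some z ∈ ℝᵏ and E[g] = E[f], then E[⟨g, P_t g⟩] ≥ E[⟨f, P_t f⟩]. -/

import Mathlib

open MeasureTheory ProbabilityTheory MvPolynomial
open scoped Classical

noncomputable section

namespace GaussNS

/-- The standard Gaussian measure `γ` on `ι → ℝ`. -/
def gaussianPi (ι : Type*) [Fintype ι] : Measure (ι → ℝ) :=
  Measure.pi fun _ => gaussianReal 0 1

/-- `Fin k` embedded as the standard basis vectors `e₁, …, e_k` of `ℝᵏ`. -/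
def basisVec {k : ℕ} (i : Fin k) : Fin k → ℝ := fun j => if j = i then 1 else 0

/-- The Ornstein–Uhlenbeck operator `P_t` acting on scalar functions:
`(P_t f)(x) = ∫ f(e^{-t} x + √(1-e^{-2t}) y) dγ(y)`. -/
def ouOp {ι : Type*} [Fintype ι] (t : ℝ) (f : (ι → ℝ) → ℝ) (x : ι → ℝ) : ℝ :=
  ∫ y, f (fun i => Real.exp (-t) * x i + Real.sqrt (1 - Real.exp (-2 * t)) * y i) ∂gaussianPi ι

/-- Noise stability `E⟨f, P_t f⟩` of a `[k]`-valued function on Gaussian space,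
where `f` is identified with a basis-vector-valued function. -/
def noiseStab {ι : Type*} [Fintype ι] {k : ℕ} (t : ℝ) (f : (ι → ℝ) → Fin k) : ℝ :=
  ∫ x, ∑ j, basisVec (f x) j * ouOp t (fun y => basisVec (f y) j) x ∂gaussianPi ι

/-- The mean vector `E[f] ∈ Δ_k` of a `[k]`-valued function. -/
def gMean {ι : Type*} [Fintype ι] {k : ℕ} (f : (ι → ℝ) → Fin k) : Fin k → ℝ :=
  fun j => ∫ x, basisVec (f x) j ∂gaussianPi ι

/-- The multivariate polynomial threshold function `PTF(p₁,…,p_k)`: value `j` if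
`p j > 0` and `p i ≤ 0` for all `i ≠ j`, and the first index otherwise. -/
def ptf {ι : Type*} {k : ℕ} [NeZero k] (p : Fin k → MvPolynomial ι ℝ) (x : ι → ℝ) : Fin k :=
  if h : ∃ j, 0 < eval x (p j) ∧ ∀ i, i ≠ j → eval x (p i) ≤ 0 then h.choose else 0

/-- Collision set of a multivariate PTF: points where the number of strictly
positive `p j` is not exactly one. -/
def collisionSet {ι : Type*} {k : ℕ} (p : Fin k → MvPolynomial ι ℝ) : Set (ι → ℝ) :=
  {x | ¬ ∃! j, 0 < eval x (p j)}

/-- Gaussian expectation of a polynomial. -/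
def gExp {ι : Type*} [Fintype ι] (p : MvPolynomial ι ℝ) : ℝ :=
  ∫ x, eval x p ∂gaussianPi ι

/-- Gaussian variance of a polynomial. -/
def gVar {ι : Type*} [Fintype ι] (p : MvPolynomial ι ℝ) : ℝ :=
  (∫ x, (eval x p) ^ 2 ∂gaussianPi ι) - gExp p ^ 2

/-- A family `p₁,…,p_k` of polynomials is `(d, δ)`-balanced if each `p i` has Gaussian
variance `1` and `|E[p i]| ≤ (log (k d / δ))^{d/2}`. -/
def balancedFam {ι : Type*} [Fintype ι] {k : ℕ} (d : ℕ) (δ : ℝ)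
    (p : Fin k → MvPolynomial ι ℝ) : Prop :=
  ∀ i, gVar (p i) = 1 ∧ |gExp (p i)| ≤ Real.log ((k : ℝ) * d / δ) ^ ((d : ℝ) / 2)

/-- The normalized multivariate Hermite polynomial `H_S(x) = ∏ i, H_{S i}(x i)/√(S i)!`. -/
def hermiteH {ι : Type*} [Fintype ι] (S : ι → ℕ) (x : ι → ℝ) : ℝ :=
  ∏ i, (Polynomial.aeval (x i) (Polynomial.hermite (S i)) / Real.sqrt (Nat.factorial (S i)))

/-- The Hermite coefficient `f̂(S) = E[f · H_S]`. -/
def hermCoeff {ι : Type*} [Fintype ι] (f : (ι → ℝ) → ℝ) (S : ι → ℕ) : ℝ :=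
  ∫ x, f x * hermiteH S x ∂gaussianPi ι

/-- Hermite weight `W^{>d}[f] = Σ_{|S| > d} ‖f̂(S)‖²` of a vector-valued function. -/
def wAbove {ι : Type*} [Fintype ι] {k : ℕ} (d : ℕ) (f : (ι → ℝ) → Fin k → ℝ) : ℝ :=
  ∑' S : ι → ℕ, if d < ∑ i, S i then ∑ j, hermCoeff (fun x => f x j) S ^ 2 else 0

/-- Hermite weight `W^{≥d}[f] = Σ_{|S| ≥ d} f̂(S)²` of a scalar function. -/
def wGE {ι : Type*} [Fintype ι] (d : ℕ) (f : (ι → ℝ) → ℝ) : ℝ :=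
  ∑' S : ι → ℕ, if d ≤ ∑ i, S i then hermCoeff f S ^ 2 else 0

/-- Squared `L²(γ)` norm `Σ_{|S| = q} f̂(S)²` of the projection of `f` onto
the `q`-th Wiener chaos. -/
def chaosNormSq {ι : Type*} [Fintype ι] (q : ℕ) (f : (ι → ℝ) → ℝ) : ℝ :=
  ∑' S : ι → ℕ, if (∑ i, S i) = q then hermCoeff f S ^ 2 else 0

/-- Frobenius norm of a tensor. -/
def frobNorm {α ι : Type*} [Fintype α] [Fintype ι] (T : (α → ι) → ℝ) : ℝ :=
  Real.sqrt (∑ t, T t ^ 2)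

/-- Contraction product `f ⊗_r g` of an order-`p` and an order-`q` tensor along `r`
indices, presented as a tensor in the remaining `(p-r)` and `(q-r)` indices. -/
def contr {ι : Type*} [Fintype ι] {p q r : ℕ} (hp : r ≤ p) (hq : r ≤ q)
    (f : (Fin p → ι) → ℝ) (g : (Fin q → ι) → ℝ)
    (a : Fin (p - r) → ι) (b : Fin (q - r) → ι) : ℝ :=
  ∑ z : Fin r → ι,
    f (fun i => Fin.append a z (Fin.cast (Nat.sub_add_cancel hp).symm i)) *
      g (fun i => Fin.append b z (Fin.cast (Nat.sub_add_cancel hq).symm i))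

/-- `λ_{S,S̄}(A)`: the largest singular value of the matricization of `A` along the
partition `(S, S̄)` of its index set. -/
def lamPart {ι : Type*} [Fintype ι] {q : ℕ} (A : (Fin q → ι) → ℝ) (S : Finset (Fin q)) : ℝ :=
  ⨆ g : ({i // i ∈ S} → ι) → ℝ, ⨆ h : ({i // i ∉ S} → ι) → ℝ,
    (∑ t : Fin q → ι, A t * g (fun i => t i.1) * h (fun i => t i.1)) /
      (frobNorm g * frobNorm h)

/-- `λ_max(A)`: maximum of `λ_{S,S̄}(A)` over nontrivial partitions `(S, S̄)`. -/
def lamMax {ι : Type*} [Fintype ι] {q : ℕ} (A : (Fin q → ι) → ℝ) : ℝ :=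
  ⨆ S : {S : Finset (Fin q) // S ≠ ∅ ∧ S ≠ Finset.univ}, lamPart A S.1

/-- The symmetric tensor `A_q` with `p = Σ_q I_q(A_q)` for a multilinear polynomial
(in terms of its Hermite coefficients). -/
def chaosTensor {ι : Type*} [Fintype ι] [DecidableEq ι] (f : (ι → ℝ) → ℝ) (q : ℕ) :
    (Fin q → ι) → ℝ :=
  fun t => if Function.Injective t then
      hermCoeff f (fun i => (Finset.univ.filter fun j => t j = i).card) / Real.sqrt (Nat.factorial q)
    else 0

/-- `λ_max(p) = max_{2 ≤ q ≤ deg p} λ_max(A_q)`. -/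
def polyLamMax {ι : Type*} [Fintype ι] [DecidableEq ι] (p : MvPolynomial ι ℝ) : ℝ :=
  ⨆ q : {q : ℕ // 2 ≤ q ∧ q ≤ p.totalDegree}, lamMax (chaosTensor (fun x => eval x p) q.1)

/-- A polynomial is `δ`-eigenregular if `λ_max(p) ≤ δ √(Var p)`. -/
def eigenregular {ι : Type*} [Fintype ι] [DecidableEq ι] (δ : ℝ) (p : MvPolynomial ι ℝ) : Prop :=
  polyLamMax p ≤ δ * Real.sqrt (gVar p)

/-- `p` lies in the `j`-th Wiener chaos `W^j`. -/
def inChaos {ι : Type*} [Fintype ι] (j : ℕ) (p : MvPolynomial ι ℝ) : Prop :=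
  ∀ S : ι → ℕ, (∑ i, S i) ≠ j → hermCoeff (fun x => eval x p) S = 0

/-- Expectation over the uniform measure on the hypercube `{-1,1}ⁿ ≃ Boolⁿ`. -/
def cubeE {n : ℕ} (g : (Fin n → Bool) → ℝ) : ℝ := (∑ x, g x) / 2 ^ n

/-- The Bonami–Beckner operator `T_ρ` on the hypercube. -/
def bbOp {n : ℕ} (ρ : ℝ) (g : (Fin n → Bool) → ℝ) (x : Fin n → Bool) : ℝ :=
  ∑ y : Fin n → Bool, (∏ i, if y i = x i then (1 + ρ) / 2 else (1 - ρ) / 2) * g y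

/-- Noise stability `E⟨f, T_ρ f⟩` on the hypercube of a `[k]`-valued function. -/
def cubeStab {n k : ℕ} (ρ : ℝ) (f : (Fin n → Bool) → Fin k) : ℝ :=
  cubeE fun x => ∑ j, basisVec (f x) j * bbOp ρ (fun y => basisVec (f y) j) x

/-- Influence of coordinate `i`: `Inf_i(f) = E_z[Var(f_{z,-i})]`, computed as
`E_x[‖f(x) - f(x^{⊕i})‖² / 4]`. -/
def influence {n k : ℕ} (i : Fin n) (f : (Fin n → Bool) → Fin k → ℝ) : ℝ :=
  cubeE fun x => (∑ j, (f x j - f (Function.update x i (!(x i))) j) ^ 2) / 4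

/-- `g ∈ T_z(F)`: `g` is a measurable rounding of `F` by thresholding at `z`, i.e.
`⟨e_{g(x)}, F(x) - z⟩ ≥ F_i(x) - z_i` for all `i` and `x`. -/
def memTz {ι : Type*} [Fintype ι] {k : ℕ} (z : Fin k → ℝ) (F : (ι → ℝ) → Fin k → ℝ)
    (g : (ι → ℝ) → Fin k) : Prop :=
  Measurable (fun x => basisVec (g x)) ∧ ∀ x i, F x i - z i ≤ F x (g x) - z (g x)

/-- `V` bounds the Gaussian total variation `E[|∇f|]` of `f`, characterized
distributionally: for every `C¹` compactly supported vector field `φ` with `‖φ‖ ≤ 1`,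
`∫ f · (div φ - ⟨x, φ⟩) dγ ≤ V`.  The least such `V` is `E[|∇f|]`. -/
def gaussTV {n : ℕ} (f : (Fin n → ℝ) → ℝ) (V : ℝ) : Prop :=
  ∀ φ : (Fin n → ℝ) → (Fin n → ℝ), ContDiff ℝ 1 φ → HasCompactSupport φ →
    (∀ x, Real.sqrt (∑ i, φ x i ^ 2) ≤ 1) →
    (∫ x, f x * ((∑ i, fderiv ℝ (fun y => φ y i) x (Pi.single i 1)) - ∑ i, x i * φ x i)
        ∂gaussianPi (Fin n)) ≤ V

/-- Evaluation of a polynomial at the noisy point `e^{-t} x + √(1-e^{-2t}) y`. -/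
def corrEval {m : ℕ} (t : ℝ) (p : MvPolynomial (Fin m) ℝ)
    (xy : (Fin m → ℝ) × (Fin m → ℝ)) : ℝ :=
  eval (fun i => Real.exp (-t) * xy.1 i + Real.sqrt (1 - Real.exp (-2 * t)) * xy.2 i) p

end GaussNS

open GaussNS

namespace GaussNS

variable {ι : Type*} [Fintype ι]

instance isGaussian_gaussianPi : IsGaussian (gaussianPi ι) := by
  have h : (stdGaussian (EuclideanSpace ℝ ι)).map
      (PiLp.continuousLinearEquiv 2 ℝ fun _ : ι => ℝ) = gaussianPi ι := by
    rw [← map_pi_eq_stdGaussian, Measure.map_map (by fun_prop) (by fun_prop)]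
    exact Measure.map_id
  rw [← h]
  infer_instance

lemma integral_id_gaussianPi : (gaussianPi ι)[id] = 0 := by
  ext i
  rw [eval_integral fun i => Integrable.eval IsGaussian.integrable_id i]
  have := integral_comp_eval (μ := fun _ : ι => gaussianReal 0 1) (i := i) (f := id)
    (by fun_prop)
  simpa [gaussianPi] using this

/-- The product of two standard Gaussian measures is rotation invariant. -/
lemma integral_comp_rotation {c d : ℝ} (hcd : c ^ 2 + d ^ 2 = 1)
    {F : (ι → ℝ) × (ι → ℝ) → ℝ} (hF : Measurable F) :
    ∫ p, F (c • p.1 + d • p.2, -d • p.1 + c • p.2) ∂(gaussianPi ι).prod (gaussianPi ι) =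
      ∫ p, F p ∂(gaussianPi ι).prod (gaussianPi ι) := by
  obtain ⟨θ, rfl, rfl⟩ : ∃ θ, Real.cos θ = c ∧ Real.sin θ = d := by
    have hn : ‖(⟨c, d⟩ : ℂ)‖ = 1 := by
      rw [Complex.norm_def, Complex.normSq_mk, ← sq, ← sq, hcd, Real.sqrt_one]
    refine ⟨Complex.arg ⟨c, d⟩, ?_, ?_⟩
    · rw [Complex.cos_arg (by rw [← norm_ne_zero_iff, hn]; exact one_ne_zero), hn, div_one]
    · rw [Complex.sin_arg, hn, div_one]
  conv_rhs => rw [← IsGaussian.map_rotation_eq_self (integral_id_gaussianPi (ι := ι)) θ]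
  rw [integral_map (by fun_prop) hF.aestronglyMeasurable]
  rfl

lemma ouOp_eq (t : ℝ) (h : (ι → ℝ) → ℝ) (x : ι → ℝ) :
    ouOp t h x = ∫ y, h (Real.exp (-t) • x + √(1 - Real.exp (-2 * t)) • y) ∂gaussianPi ι := rfl

lemma measurable_ouOp (t : ℝ) {h : (ι → ℝ) → ℝ} (hh : Measurable h) : Measurable (ouOp t h) := by
  have : StronglyMeasurable fun p : (ι → ℝ) × (ι → ℝ) =>
      h (Real.exp (-t) • p.1 + √(1 - Real.exp (-2 * t)) • p.2) :=
    (hh.comp (by fun_prop)).stronglyMeasurable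
  exact this.integral_prod_right'.measurable

lemma abs_ouOp_le (t : ℝ) {h : (ι → ℝ) → ℝ} {C : ℝ} (hC : ∀ x, |h x| ≤ C) (x : ι → ℝ) :
    |ouOp t h x| ≤ C := by
  simpa [ouOp_eq] using norm_integral_le_of_norm_le_const (μ := gaussianPi ι)
    (f := fun y => h (Real.exp (-t) • x + √(1 - Real.exp (-2 * t)) • y))
    (Filter.Eventually.of_forall fun y => hC _)

lemma integrable_of_abs_le {X : Type*} [MeasurableSpace X] {μ : Measure X} [IsFiniteMeasure μ]
    {h : X → ℝ} (hh : Measurable h) {C : ℝ} (hC : ∀ x, |h x| ≤ C) : Integrable h μ :=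
  .of_bound hh.aestronglyMeasurable C (Filter.Eventually.of_forall hC)

/-- Gaussian averages compose: independent Gaussian vectors scaled by `a` and `b` sum to a Gaussian
vector scaled by `q`, where `q ^ 2 = a ^ 2 + b ^ 2`. -/
lemma integral_integral_gaussianPi_add {h : (ι → ℝ) → ℝ} (hh : Measurable h) {C : ℝ}
    (hC : ∀ x, |h x| ≤ C) {a b q : ℝ} (hq : q ≠ 0) (habq : a ^ 2 + b ^ 2 = q ^ 2) (x : ι → ℝ) :
    ∫ y, ∫ v, h (x + a • y + b • v) ∂gaussianPi ι ∂gaussianPi ι =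
      ∫ y, h (x + q • y) ∂gaussianPi ι := by
  have hcd : (a / q) ^ 2 + (b / q) ^ 2 = 1 := by
    field_simp
    exact habq
  have hrot := integral_comp_rotation hcd
    (F := fun p : (ι → ℝ) × (ι → ℝ) => h (x + q • p.1)) (hh.comp (by fun_prop))
  simp only [smul_add, smul_smul, mul_div_cancel₀ _ hq, ← add_assoc] at hrot
  rw [integral_integral (f := fun y v => h (x + a • y + b • v))
    (integrable_of_abs_le (hh.comp (by fun_prop)) fun _ => hC _), hrot,
    integral_fun_fst fun y => h (x + q • y)]
  simp

/-- Since `P_t = P_{t/2} ∘ P_{t/2}` with `P_{t/2}` self-adjoint, `E[h P_t k]` is the inner product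
of `P_{t/2} h` and `P_{t/2} k`. -/
lemma integral_mul_ouOp {t : ℝ} (ht : 0 < t) {h k : (ι → ℝ) → ℝ} (hh : Measurable h)
    (hk : Measurable k) {C D : ℝ} (hC : ∀ x, |h x| ≤ C) (hD : ∀ x, |k x| ≤ D) :
    ∫ x, h x * ouOp t k x ∂gaussianPi ι =
      ∫ x, ouOp (t / 2) h x * ouOp (t / 2) k x ∂gaussianPi ι := by
  have hes : Real.exp (-2 * (t / 2)) = Real.exp (-(t / 2)) ^ 2 := by
    rw [← Real.exp_nat_mul]; congr 1; push_cast; ring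
  have het : Real.exp (-2 * t) = Real.exp (-t) ^ 2 := by
    rw [← Real.exp_nat_mul]; congr 1; push_cast; ring
  have hst : Real.exp (-t) = Real.exp (-(t / 2)) ^ 2 := by
    rw [← hes]; congr 1; ring
  have hlt : Real.exp (-t) < 1 := by simpa using ht
  have hpos := Real.exp_pos (-t)
  set s := Real.exp (-(t / 2)) with hs
  set r := √(1 - Real.exp (-2 * (t / 2))) with hr
  set q := √(1 - Real.exp (-2 * t)) with hq
  have hr2 : r ^ 2 = 1 - s ^ 2 := by
    rw [hr, Real.sq_sqrt (by rw [hes]; nlinarith), hes]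
  have hq2 : q ^ 2 = 1 - s ^ 4 := by
    rw [hq, Real.sq_sqrt (by rw [het]; nlinarith), het, hst]; ring
  have hq0 : q ≠ 0 := by
    rw [← pow_ne_zero_iff two_ne_zero, hq2]
    nlinarith
  have hmk := measurable_ouOp (t / 2) hk
  have hbk := abs_ouOp_le (t / 2) hD
  have hbd : ∀ x y, |h x * ouOp (t / 2) k y| ≤ C * D := fun x y => by
    rw [abs_mul]
    exact mul_le_mul (hC x) (hbk y) (abs_nonneg _) ((abs_nonneg _).trans (hC x))
  have hrot := integral_comp_rotation (c := s) (d := r) (by rw [hr2]; ring)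
    (F := fun p : (ι → ℝ) × (ι → ℝ) => h p.1 * ouOp (t / 2) k (s • p.1 + (-r) • p.2))
    ((hh.comp (by fun_prop)).mul (hmk.comp (by fun_prop)))
  have hback : ∀ w u : ι → ℝ, s • (s • w + r • u) + (-r) • (-r • w + s • u) = w := fun w u => by
    ext i
    simp only [Pi.add_apply, Pi.smul_apply, smul_eq_mul]
    linear_combination w i * hr2
  simp only [hback] at hrot
  have hint : ∀ {φ ψ : (ι → ℝ) × (ι → ℝ) → ι → ℝ}, Measurable φ → Measurable ψ →
      Integrable (fun p => h (φ p) * ouOp (t / 2) k (ψ p))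
        ((gaussianPi ι).prod (gaussianPi ι)) := fun hφ hψ =>
    integrable_of_abs_le ((hh.comp hφ).mul (hmk.comp hψ)) fun _ => hbd _ _
  rw [integral_prod _ (hint (by fun_prop) (by fun_prop)),
    integral_prod _ (hint (by fun_prop) (by fun_prop))] at hrot
  simp only [integral_mul_const, integral_const_mul] at hrot
  refine Eq.trans ?_ hrot.symm
  refine integral_congr_ae (Filter.Eventually.of_forall fun x => ?_)
  simp only [ouOp_eq, ← hs, ← hr, ← hq]
  congr 1
  have hsemi := integral_integral_gaussianPi_add hk hD (a := -(s * r)) (b := r) hq0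
    (by rw [hq2]; linear_combination (s ^ 2 + 1) * hr2) (Real.exp (-t) • x)
  rw [← hsemi, hst]
  simp only [smul_add, smul_smul, sq, mul_neg]

end GaussNS

/-- If `g ∈ T_z(P_t f)` for some `z ∈ ℝᵏ` and `E[g] = E[f]`, then
`E⟨g, P_t g⟩ ≥ E⟨f, P_t f⟩`. -/
theorem stmt8 {n k : ℕ} (t : ℝ) (ht : 0 < t)
    (f : (Fin n → ℝ) → Fin k) (hf : Measurable fun x => basisVec (f x))
    (z : Fin k → ℝ) (g : (Fin n → ℝ) → Fin k)
    (hg : memTz z (fun x j => ouOp t (fun y => basisVec (f y) j) x) g)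
    (hmean : ∀ j, gMean g j = gMean f j) :
    noiseStab t g ≥ noiseStab t f := by
  have hmf : ∀ j, Measurable fun x => basisVec (f x) j := measurable_pi_iff.1 hf
  have hmg : ∀ j, Measurable fun x => basisVec (g x) j := measurable_pi_iff.1 hg.1
  have hb : ∀ i j : Fin k, |basisVec i j| ≤ 1 := fun i j => by
    unfold basisVec; split_ifs <;> simp
  have hint : ∀ {u v : (Fin n → ℝ) → ℝ}, Measurable u → Measurable v →
      (∀ x, |u x| ≤ 1) → (∀ x, |v x| ≤ 1) →
      Integrable (fun x => u x * v x) (gaussianPi (Fin n)) := fun hu hv hu1 hv1 =>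
    integrable_of_abs_le (C := 1) (hu.mul hv) fun x => by
      rw [abs_mul]; exact mul_le_one₀ (hu1 x) (abs_nonneg _) (hv1 x)
  have hP : ∀ (s : ℝ) {u : (Fin n → ℝ) → Fin k}, (∀ j, Measurable fun x => basisVec (u x) j) →
      ∀ j, Measurable (ouOp s fun y => basisVec (u y) j) := fun s _ hu j => measurable_ouOp s (hu j)
  have hPb : ∀ (s : ℝ) (u : (Fin n → ℝ) → Fin k) (j : Fin k) (x : Fin n → ℝ),
      |ouOp s (fun y => basisVec (u y) j) x| ≤ 1 := fun s u j =>
    abs_ouOp_le s fun x => hb (u x) j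
  have hround : ∑ j, ∫ x, basisVec (f x) j * ouOp t (fun y => basisVec (f y) j) x
        ∂gaussianPi (Fin n) ≤
      ∑ j, ∫ x, basisVec (g x) j * ouOp t (fun y => basisVec (f y) j) x ∂gaussianPi (Fin n) := by
    have hz : ∑ j, ∫ x, basisVec (f x) j * z j ∂gaussianPi (Fin n) =
        ∑ j, ∫ x, basisVec (g x) j * z j ∂gaussianPi (Fin n) := by
      refine Finset.sum_congr rfl fun j _ => ?_
      rw [integral_mul_const, integral_mul_const]
      exact congrArg (· * z j) (hmean j).symm
    have hintP : ∀ {u : (Fin n → ℝ) → Fin k}, (∀ j, Measurable fun x => basisVec (u x) j) → ∀ j,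
        Integrable (fun x => basisVec (u x) j * ouOp t (fun y => basisVec (f y) j) x)
          (gaussianPi (Fin n)) := fun {u} hu j =>
      hint (hu j) (hP t hmf j) (fun x => hb _ _) (hPb t f j)
    have hintz : ∀ {u : (Fin n → ℝ) → Fin k}, (∀ j, Measurable fun x => basisVec (u x) j) → ∀ j,
        Integrable (fun x => basisVec (u x) j * z j) (gaussianPi (Fin n)) := fun {u} hu j =>
      (integrable_of_abs_le (hu j) fun x => hb (u x) j).mul_const _
    have hintd : ∀ {u : (Fin n → ℝ) → Fin k}, (∀ j, Measurable fun x => basisVec (u x) j) → ∀ j,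
        Integrable (fun x => basisVec (u x) j * ouOp t (fun y => basisVec (f y) j) x -
          basisVec (u x) j * z j) (gaussianPi (Fin n)) := fun {u} hu j =>
      (hintP hu j).sub (hintz hu j)
    rw [← sub_le_sub_iff_right (∑ j, ∫ x, basisVec (f x) j * z j ∂gaussianPi (Fin n))]
    conv_rhs => rw [hz]
    simp only [← Finset.sum_sub_distrib]
    simp only [← integral_sub (hintP hmf _) (hintz hmf _),
      ← integral_sub (hintP hmg _) (hintz hmg _)]
    rw [← integral_finsetSum _ fun j _ => hintd hmf j,
      ← integral_finsetSum _ fun j _ => hintd hmg j]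
    refine integral_mono
      (integrable_finsetSum _ fun j _ => hintd hmf j)
      (integrable_finsetSum _ fun j _ => hintd hmg j) fun x => ?_
    simpa [← mul_sub, basisVec] using hg.2 x (f x)
  have hstab : ∀ {u : (Fin n → ℝ) → Fin k}, (∀ j, Measurable fun x => basisVec (u x) j) →
      noiseStab t u =
        ∑ j, ∫ x, basisVec (u x) j * ouOp t (fun y => basisVec (u y) j) x ∂gaussianPi (Fin n) :=
    fun {u} hu => integral_finsetSum _ fun j _ =>
      hint (hu j) (hP t hu j) (fun x => hb _ _) (hPb t u j)
  rw [hstab hmf, hstab hmg]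
  have hpsd : ∀ j, 2 * ∫ x, basisVec (g x) j * ouOp t (fun y => basisVec (f y) j) x
        ∂gaussianPi (Fin n) ≤
      (∫ x, basisVec (g x) j * ouOp t (fun y => basisVec (g y) j) x ∂gaussianPi (Fin n)) +
        ∫ x, basisVec (f x) j * ouOp t (fun y => basisVec (f y) j) x ∂gaussianPi (Fin n) := by
    intro j
    rw [integral_mul_ouOp ht (hmg j) (hmf j) (fun x => hb _ _) (fun x => hb _ _),
      integral_mul_ouOp ht (hmg j) (hmg j) (fun x => hb _ _) (fun x => hb _ _),
      integral_mul_ouOp ht (hmf j) (hmf j) (fun x => hb _ _) (fun x => hb _ _),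
      ← integral_const_mul, ← integral_add
        (hint (hP _ hmg j) (hP _ hmg j) (hPb _ g j) (hPb _ g j))
        (hint (hP _ hmf j) (hP _ hmf j) (hPb _ f j) (hPb _ f j))]
    refine integral_mono
      ((hint (hP _ hmg j) (hP _ hmf j) (hPb _ g j) (hPb _ f j)).const_mul 2)
      ((hint (hP _ hmg j) (hP _ hmg j) (hPb _ g j) (hPb _ g j)).add
        (hint (hP _ hmf j) (hP _ hmf j) (hPb _ f j) (hPb _ f j))) fun x => ?_
    simpa only [mul_assoc, sq] using two_mul_le_add_sq
      (ouOp (t / 2) (fun y => basisVec (g y) j) x) (ouOp (t / 2) (fun y => basisVec (f y) j) x)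
  have hsum := Finset.sum_le_sum fun j (_ : j ∈ Finset.univ) => hpsd j
  rw [← Finset.mul_sum, Finset.sum_add_distrib] at hsum
  linarith
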